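/- Let C = ⟨(b(x) | 0), (ℓ(x) | a(x))⟩ be a Z₂-double cyclic code, where b(x) divides x^r−1, a(x) divides x^s−1, the subcode {(p(x) | 0) ∈ C} equals ⟨(b(x) | 0)⟩, and a(x) generates C_s. Set κ = deg b(x) − deg gcd(b(x), ℓ(x)). Then |C_r| = 2^{r − deg b(x) + κ}, |C_s| = 2^{s − deg a(x)}, |(C_r)^⊥| = 2^{deg b(x) − κ}, |(C_s)^⊥| = 2^{deg a(x)}, |(C^⊥)_r| = 2^{deg b(x)}, and |(C^⊥)_s| = 2^{deg a(x) + κ}. -/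

import Mathlib

open Polynomial

noncomputable section

/-- The polynomial ring `Z₂[x]`. -/
abbrev Z2P : Type := Polynomial (ZMod 2)

/-- The quotient ring `Z₂[x]/(x^n - 1)`. -/
abbrev Rq (n : ℕ) : Type := Z2P ⧸ Ideal.span {(X : Z2P) ^ n - 1}

/-- The canonical projection `Z₂[x] → Z₂[x]/(x^n - 1)`. -/
def mkQ (n : ℕ) : Z2P →+* Rq n := Ideal.Quotient.mk _

/-- The element of `Z₂[x]/(x^n − 1)` associated to a vector `v ∈ Z₂^n` via coefficients. -/
def ofVec (n : ℕ) (v : Fin n → ZMod 2) : Rq n :=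
  mkQ n (∑ i : Fin n, Polynomial.C (v i) * (X : Z2P) ^ (i : ℕ))

/-- The dual code `C^⊥` of a `Z₂`-double cyclic code `C ⊆ R_{r,s}`, computed with respect to
the standard inner product on `Z₂^{r+s}` under the coefficient identification
`R_{r,s} ≅ Z₂^r × Z₂^s`. -/
def dualCode (r s : ℕ) (C : Submodule Z2P (Rq r × Rq s)) : Set (Rq r × Rq s) :=
  {c | ∃ w : (Fin r → ZMod 2) × (Fin s → ZMod 2),
        (ofVec r w.1, ofVec s w.2) = c ∧
        ∀ u : (Fin r → ZMod 2) × (Fin s → ZMod 2),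
          (ofVec r u.1, ofVec s u.2) ∈ C →
          (∑ i, u.1 i * w.1 i) + (∑ j, u.2 j * w.2 j) = 0}

open Module

theorem natDegree_X_pow_sub_one_zmod (n : ℕ) : ((X : Z2P) ^ n - 1).natDegree = n := by
  simpa using natDegree_X_pow_sub_C (n := n) (r := (1 : ZMod 2))

theorem X_pow_sub_one_zmod_ne_zero {n : ℕ} (hn : 0 < n) : (X : Z2P) ^ n - 1 ≠ 0 := by
  simpa using X_pow_sub_C_ne_zero hn (1 : ZMod 2)

theorem finrank_Rq (n : ℕ) : finrank (ZMod 2) (Rq n) = n := by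
  rw [finrank_quotient_span_eq_natDegree, natDegree_X_pow_sub_one_zmod]

theorem finite_Rq {n : ℕ} (hn : 0 < n) : Module.Finite (ZMod 2) (Rq n) :=
  Module.finite_of_finrank_pos (by rwa [finrank_Rq])

theorem mkQ_eq_zero_iff {n : ℕ} {p : Z2P} : mkQ n p = 0 ↔ (X : Z2P) ^ n - 1 ∣ p := by
  rw [mkQ, Ideal.Quotient.eq_zero_iff_mem, Ideal.mem_span_singleton]

theorem smul_mkQ {n : ℕ} (p q : Z2P) : p • mkQ n q = mkQ n (p * q) := rfl

/-- The linear map sending a vector to the class of the polynomial with these coefficients. -/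
def ofVecHom (n : ℕ) : (Fin n → ZMod 2) →ₗ[ZMod 2] Rq n where
  toFun := ofVec n
  map_add' v w := by
    simp [ofVec, add_mul, Finset.sum_add_distrib]
  map_smul' c v := by
    have h : (∑ i : Fin n, Polynomial.C ((c • v) i) * (X : Z2P) ^ (i : ℕ)) =
        c • ∑ i : Fin n, Polynomial.C (v i) * (X : Z2P) ^ (i : ℕ) := by
      simp [Finset.mul_sum, mul_assoc, Polynomial.smul_eq_C_mul]
    rw [ofVec, h]
    rfl

theorem ofVecHom_injective {n : ℕ} (hn : 0 < n) : Function.Injective (ofVecHom n) := by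
  rw [injective_iff_map_eq_zero]
  intro v hv
  have h0 : (∑ i : Fin n, Polynomial.C (v i) * (X : Z2P) ^ (i : ℕ)) = 0 := by
    refine eq_zero_of_dvd_of_degree_lt (mkQ_eq_zero_iff.1 hv) ?_
    rw [degree_eq_natDegree (X_pow_sub_one_zmod_ne_zero hn), natDegree_X_pow_sub_one_zmod]
    exact degree_sum_fin_lt v
  funext i
  simpa [finsetSum_coeff, coeff_C_mul, coeff_X_pow, Fin.val_inj] using
    congrArg (fun p : Z2P => p.coeff i) h0

/-- The coefficient identification of `Z₂^n` with `Z₂[x]/(x^n - 1)`. -/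
def vecEquiv {n : ℕ} (hn : 0 < n) : (Fin n → ZMod 2) ≃ₗ[ZMod 2] Rq n :=
  haveI := finite_Rq hn
  LinearEquiv.ofInjectiveOfFinrankEq (ofVecHom n) (ofVecHom_injective hn) (by simp [finrank_Rq])

theorem vecEquiv_apply {n : ℕ} (hn : 0 < n) (v : Fin n → ZMod 2) : vecEquiv hn v = ofVec n v :=
  rfl

theorem finrank_comap_vecEquiv {n : ℕ} (hn : 0 < n) (M : Submodule Z2P (Rq n)) :
    finrank (ZMod 2) ((M.restrictScalars (ZMod 2)).comap (vecEquiv hn : (Fin n → ZMod 2) →ₗ[ZMod 2] Rq n)) =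
      finrank (ZMod 2) (M.restrictScalars (ZMod 2)) := by
  rw [Submodule.comap_equiv_eq_map_symm]
  exact LinearEquiv.finrank_map_eq _ _

theorem finrank_span_mkQ {n : ℕ} (hn : 0 < n) {g : Z2P} (hg : g ∣ (X : Z2P) ^ n - 1) :
    finrank (ZMod 2) ((Submodule.span Z2P {mkQ n g}).restrictScalars (ZMod 2)) =
      n - g.natDegree := by
  obtain ⟨h, hh⟩ := hg
  have hne : g * h ≠ 0 := hh ▸ X_pow_sub_one_zmod_ne_zero hn
  have hdeg : n = g.natDegree + h.natDegree := by
    rw [← natDegree_mul (left_ne_zero_of_mul hne) (right_ne_zero_of_mul hne), ← hh,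
      natDegree_X_pow_sub_one_zmod]
  have hker : LinearMap.ker (LinearMap.toSpanSingleton Z2P (Rq n) (mkQ n g)) =
      Ideal.span {h} := by
    ext p
    rw [LinearMap.mem_ker, LinearMap.toSpanSingleton_apply, smul_mkQ, mkQ_eq_zero_iff, hh,
      Ideal.mem_span_singleton, mul_comm p, mul_dvd_mul_iff_left (left_ne_zero_of_mul hne)]
  rw [← LinearMap.range_toSpanSingleton]
  have e := (Submodule.quotEquivOfEq _ _ hker).symm.trans
    (LinearMap.toSpanSingleton Z2P (Rq n) (mkQ n g)).quotKerEquivRange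
  have := (e.restrictScalars (ZMod 2)).finrank_eq
  rw [finrank_quotient_span_eq_natDegree] at this
  exact this.symm.trans (by omega)

section Projections

variable {K V₁ V₂ : Type*} [Field K] [AddCommGroup V₁] [Module K V₁] [AddCommGroup V₂] [Module K V₂]
  [FiniteDimensional K V₁] [FiniteDimensional K V₂] (W : Submodule K (V₁ × V₂))

theorem finrank_map_snd_add_finrank_comap_inl :
    finrank K (W.map (LinearMap.snd K V₁ V₂)) + finrank K (W.comap (LinearMap.inl K V₁ V₂)) =
      finrank K W := by
  have h : (W.comap (LinearMap.inl K V₁ V₂)).map (LinearMap.inl K V₁ V₂) =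
      (LinearMap.ker ((LinearMap.snd K V₁ V₂).domRestrict W)).map W.subtype := by
    ext ⟨x, y⟩
    simp only [Submodule.mem_map, Submodule.mem_comap, LinearMap.inl_apply, Prod.mk.injEq,
      LinearMap.mem_ker, LinearMap.domRestrict_apply, LinearMap.snd_apply,
      Submodule.subtype_apply, Subtype.exists]
    aesop
  rw [← LinearMap.finrank_range_add_finrank_ker ((LinearMap.snd K V₁ V₂).domRestrict W),
    LinearMap.range_domRestrict, ← Submodule.finrank_map_subtype_eq W, ← h,
    (Submodule.equivMapOfInjective (LinearMap.inl K V₁ V₂) LinearMap.inl_injective _).finrank_eq]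

theorem finrank_map_fst_add_finrank_comap_inr :
    finrank K (W.map (LinearMap.fst K V₁ V₂)) + finrank K (W.comap (LinearMap.inr K V₁ V₂)) =
      finrank K W := by
  have h : (W.comap (LinearMap.inr K V₁ V₂)).map (LinearMap.inr K V₁ V₂) =
      (LinearMap.ker ((LinearMap.fst K V₁ V₂).domRestrict W)).map W.subtype := by
    ext ⟨x, y⟩
    simp only [Submodule.mem_map, Submodule.mem_comap, LinearMap.inr_apply, Prod.mk.injEq,
      LinearMap.mem_ker, LinearMap.domRestrict_apply, LinearMap.fst_apply,
      Submodule.subtype_apply, Subtype.exists]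
    aesop
  rw [← LinearMap.finrank_range_add_finrank_ker ((LinearMap.fst K V₁ V₂).domRestrict W),
    LinearMap.range_domRestrict, ← Submodule.finrank_map_subtype_eq W, ← h,
    (Submodule.equivMapOfInjective (LinearMap.inr K V₁ V₂) LinearMap.inr_injective _).finrank_eq]

end Projections

section Orthogonal

variable {K ι κ : Type*} [Field K] [Fintype ι] [Fintype κ]

variable (K ι) in
/-- The standard inner product on `K^ι`. -/
def stdForm : LinearMap.BilinForm K (ι → K) := dotProductBilin K K

theorem stdForm_apply (u w : ι → K) : stdForm K ι u w = ∑ i, u i * w i := rfl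

variable (K ι κ) in
/-- The standard inner product on `K^ι × K^κ`. -/
def stdFormProd : LinearMap.BilinForm K ((ι → K) × (κ → K)) :=
  (stdForm K ι).compl₁₂ (LinearMap.fst K _ _) (LinearMap.fst K _ _) +
    (stdForm K κ).compl₁₂ (LinearMap.snd K _ _) (LinearMap.snd K _ _)

theorem stdFormProd_apply (u w : (ι → K) × (κ → K)) :
    stdFormProd K ι κ u w = (∑ i, u.1 i * w.1 i) + ∑ j, u.2 j * w.2 j := rfl

theorem stdForm_nondegenerate : (stdForm K ι).Nondegenerate := by
  classical
  refine ⟨fun v hv => ?_, fun v hv => ?_⟩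
  · exact dotProduct_eq_zero_iff.1 hv
  · exact dotProduct_eq_zero_iff.1 fun w => (dotProduct_comm v w).trans (hv w)

theorem stdFormProd_nondegenerate : (stdFormProd K ι κ).Nondegenerate := by
  refine ⟨fun v hv => Prod.ext ?_ ?_, fun v hv => Prod.ext ?_ ?_⟩
  · exact stdForm_nondegenerate.1 _ fun w => by
      simpa [stdFormProd_apply, stdForm_apply] using hv (w, 0)
  · exact stdForm_nondegenerate.1 _ fun w => by
      simpa [stdFormProd_apply, stdForm_apply] using hv (0, w)
  · exact stdForm_nondegenerate.2 _ fun w => by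
      simpa [stdFormProd_apply, stdForm_apply] using hv (w, 0)
  · exact stdForm_nondegenerate.2 _ fun w => by
      simpa [stdFormProd_apply, stdForm_apply] using hv (0, w)

variable (W : Submodule K ((ι → K) × (κ → K)))

theorem comap_inl_orthogonal :
    ((stdFormProd K ι κ).orthogonal W).comap (LinearMap.inl K _ _) =
      (stdForm K ι).orthogonal (W.map (LinearMap.fst K _ _)) := by
  ext w
  simp [LinearMap.BilinForm.mem_orthogonal_iff, stdFormProd_apply,
    stdForm_apply]

theorem comap_inr_orthogonal :
    ((stdFormProd K ι κ).orthogonal W).comap (LinearMap.inr K _ _) =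
      (stdForm K κ).orthogonal (W.map (LinearMap.snd K _ _)) := by
  ext w
  simp [LinearMap.BilinForm.mem_orthogonal_iff, stdFormProd_apply,
    stdForm_apply]
  exact forall_comm

end Orthogonal

theorem natCard_eq_two_pow_finrank {V : Type*} [AddCommGroup V] [Module (ZMod 2) V]
    [Module.Finite (ZMod 2) V] (W : Submodule (ZMod 2) V) :
    Nat.card W = 2 ^ finrank (ZMod 2) W := by
  rw [Module.natCard_eq_pow_finrank (K := ZMod 2), Nat.card_zmod]

theorem span_pair_mkQ {n : ℕ} (b l : Z2P) :
    Submodule.span Z2P {mkQ n b, mkQ n l} = Submodule.span Z2P {mkQ n (gcd b l)} := by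
  apply le_antisymm
  · rw [Submodule.span_le, Set.pair_subset_iff]
    constructor
    · obtain ⟨c, hc⟩ := gcd_dvd_left b l
      exact Submodule.mem_span_singleton.2 ⟨c, by rw [smul_mkQ, mul_comm, ← hc]⟩
    · obtain ⟨c, hc⟩ := gcd_dvd_right b l
      exact Submodule.mem_span_singleton.2 ⟨c, by rw [smul_mkQ, mul_comm, ← hc]⟩
  · rw [Submodule.span_singleton_le_iff_mem, Submodule.mem_span_pair]
    obtain ⟨x, y, hxy⟩ := exists_gcd_eq_mul_add_mul b l
    exact ⟨x, y, by rw [smul_mkQ, smul_mkQ, ← map_add, hxy, mul_comm x, mul_comm y]⟩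

/-- Sizes of the projections of `C = ⟨(b | 0), (ℓ | a)⟩`, of their duals, and of the
projections of the dual code, where `κ = deg b − deg gcd(b, ℓ)`:
`|C_r| = 2^{r − deg b + κ}`, `|C_s| = 2^{s − deg a}`, `|(C_r)^⊥| = 2^{deg b − κ}`,
`|(C_s)^⊥| = 2^{deg a}`, `|(C^⊥)_r| = 2^{deg b}`, `|(C^⊥)_s| = 2^{deg a + κ}`. -/
theorem stmt11 (r s : ℕ) (hr : 0 < r) (hs : 0 < s) (b l a : Z2P)
    (C : Submodule Z2P (Rq r × Rq s))
    (hCdef : C = Submodule.span Z2P {((mkQ r b, 0) : Rq r × Rq s), (mkQ r l, mkQ s a)})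
    (hb : b ∣ (X : Z2P) ^ r - 1) (ha : a ∣ (X : Z2P) ^ s - 1)
    (hker : C ⊓ LinearMap.ker (LinearMap.snd Z2P (Rq r) (Rq s)) =
      Submodule.span Z2P {((mkQ r b, 0) : Rq r × Rq s)})
    (hCs : Submodule.map (LinearMap.snd Z2P (Rq r) (Rq s)) C =
      Submodule.span Z2P {mkQ s a}) :
    Nat.card (Submodule.map (LinearMap.fst Z2P (Rq r) (Rq s)) C) =
      2 ^ (r - b.natDegree + (b.natDegree - (gcd b l).natDegree)) ∧
    Nat.card (Submodule.map (LinearMap.snd Z2P (Rq r) (Rq s)) C) =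
      2 ^ (s - a.natDegree) ∧
    Nat.card {w : Fin r → ZMod 2 | ∀ u : Fin r → ZMod 2,
        ofVec r u ∈ Submodule.map (LinearMap.fst Z2P (Rq r) (Rq s)) C →
        (∑ i, u i * w i) = 0} =
      2 ^ (b.natDegree - (b.natDegree - (gcd b l).natDegree)) ∧
    Nat.card {w : Fin s → ZMod 2 | ∀ u : Fin s → ZMod 2,
        ofVec s u ∈ Submodule.map (LinearMap.snd Z2P (Rq r) (Rq s)) C →
        (∑ j, u j * w j) = 0} =
      2 ^ a.natDegree ∧
    Nat.card {p : Rq r | ∃ q : Rq s, (p, q) ∈ dualCode r s C} = 2 ^ b.natDegree ∧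
    Nat.card {q : Rq s | ∃ p : Rq r, (p, q) ∈ dualCode r s C} =
      2 ^ (a.natDegree + (b.natDegree - (gcd b l).natDegree)) := by
  have hgb : gcd b l ∣ b := gcd_dvd_left b l
  have hb0 : b ≠ 0 := ne_zero_of_dvd_ne_zero (X_pow_sub_one_zmod_ne_zero hr) hb
  have hgdeg : (gcd b l).natDegree ≤ b.natDegree := natDegree_le_of_dvd hgb hb0
  have hbdeg : b.natDegree ≤ r := by
    simpa only [natDegree_X_pow_sub_one_zmod] using
      natDegree_le_of_dvd hb (X_pow_sub_one_zmod_ne_zero hr)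
  have hadeg : a.natDegree ≤ s := by
    simpa only [natDegree_X_pow_sub_one_zmod] using
      natDegree_le_of_dvd ha (X_pow_sub_one_zmod_ne_zero hs)
  have hCr : C.map (LinearMap.fst Z2P (Rq r) (Rq s)) = Submodule.span Z2P {mkQ r (gcd b l)} := by
    rw [hCdef, Submodule.map_span, Set.image_pair]
    exact span_pair_mkQ b l
  have hCinl : C.comap (LinearMap.inl Z2P (Rq r) (Rq s)) = Submodule.span Z2P {mkQ r b} := by
    ext p
    have h := SetLike.ext_iff.1 hker (p, 0)
    simpa [Submodule.mem_span_singleton] using h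
  let e := (vecEquiv hr).prodCongr (vecEquiv hs)
  let W := (C.restrictScalars (ZMod 2)).comap (e : ((Fin r → ZMod 2) × (Fin s → ZMod 2)) →ₗ[ZMod 2] Rq r × Rq s)
  have hmem (u) : u ∈ W ↔ (ofVec r u.1, ofVec s u.2) ∈ C := Iff.rfl
  have hWr : W.map (LinearMap.fst (ZMod 2) _ _) =
      ((C.map (LinearMap.fst Z2P (Rq r) (Rq s))).restrictScalars (ZMod 2)).comap
        (vecEquiv hr : (Fin r → ZMod 2) →ₗ[ZMod 2] Rq r) := by
    ext u
    simp [hmem, (vecEquiv hs).surjective.exists, vecEquiv_apply]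
  have hWs : W.map (LinearMap.snd (ZMod 2) _ _) =
      ((C.map (LinearMap.snd Z2P (Rq r) (Rq s))).restrictScalars (ZMod 2)).comap
        (vecEquiv hs : (Fin s → ZMod 2) →ₗ[ZMod 2] Rq s) := by
    ext u
    simp [hmem, (vecEquiv hr).surjective.exists, vecEquiv_apply]
  have hWinl : W.comap (LinearMap.inl (ZMod 2) _ _) =
      ((C.comap (LinearMap.inl Z2P (Rq r) (Rq s))).restrictScalars (ZMod 2)).comap
        (vecEquiv hr : (Fin r → ZMod 2) →ₗ[ZMod 2] Rq r) := by
    ext u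
    have h0 : ofVec s 0 = 0 := (ofVecHom s).map_zero
    simp [hmem, vecEquiv_apply, h0]
  have dr : finrank (ZMod 2) (W.map (LinearMap.fst (ZMod 2) _ _)) = r - (gcd b l).natDegree := by
    rw [hWr, finrank_comap_vecEquiv, hCr, finrank_span_mkQ hr (hgb.trans hb)]
  have ds : finrank (ZMod 2) (W.map (LinearMap.snd (ZMod 2) _ _)) = s - a.natDegree := by
    rw [hWs, finrank_comap_vecEquiv, hCs, finrank_span_mkQ hs ha]
  have dinl : finrank (ZMod 2) (W.comap (LinearMap.inl (ZMod 2) _ _)) = r - b.natDegree := by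
    rw [hWinl, finrank_comap_vecEquiv, hCinl, finrank_span_mkQ hr hb]
  have dW := finrank_map_snd_add_finrank_comap_inl W
  let D := (stdFormProd (ZMod 2) (Fin r) (Fin s)).orthogonal W
  have dDr := finrank_map_fst_add_finrank_comap_inr D
  have dDs := finrank_map_snd_add_finrank_comap_inl D
  have dD : finrank (ZMod 2) D = r + s - finrank (ZMod 2) W := by
    rw [LinearMap.BilinForm.finrank_orthogonal stdFormProd_nondegenerate]
    simp
  have dor : finrank (ZMod 2) ((stdForm (ZMod 2) (Fin r)).orthogonal
      (W.map (LinearMap.fst (ZMod 2) _ _))) = (gcd b l).natDegree := by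
    rw [LinearMap.BilinForm.finrank_orthogonal stdForm_nondegenerate, dr]
    simp
    omega
  have dos : finrank (ZMod 2) ((stdForm (ZMod 2) (Fin s)).orthogonal
      (W.map (LinearMap.snd (ZMod 2) _ _))) = a.natDegree := by
    rw [LinearMap.BilinForm.finrank_orthogonal stdForm_nondegenerate, ds]
    simp
    omega
  rw [comap_inr_orthogonal, dos] at dDr
  rw [comap_inl_orthogonal, dor] at dDs
  have := finite_Rq hr
  have := finite_Rq hs
  refine ⟨?_, ?_, ?_, ?_, ?_, ?_⟩
  · rw [hCr]
    refine (natCard_eq_two_pow_finrank ((Submodule.span Z2P {mkQ r (gcd b l)}).restrictScalars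
      (ZMod 2))).trans ?_
    rw [finrank_span_mkQ hr (hgb.trans hb)]
    congr 1
    omega
  · rw [hCs]
    refine (natCard_eq_two_pow_finrank ((Submodule.span Z2P {mkQ s a}).restrictScalars
      (ZMod 2))).trans ?_
    rw [finrank_span_mkQ hs ha]
  · have h := natCard_eq_two_pow_finrank ((stdForm (ZMod 2) (Fin r)).orthogonal
      (W.map (LinearMap.fst (ZMod 2) _ _)))
    rw [dor, hWr] at h
    rw [Nat.sub_sub_self hgdeg]
    exact h
  · have h := natCard_eq_two_pow_finrank ((stdForm (ZMod 2) (Fin s)).orthogonal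
      (W.map (LinearMap.snd (ZMod 2) _ _)))
    rw [dos, hWs] at h
    exact h
  · have h : {p : Rq r | ∃ q : Rq s, (p, q) ∈ dualCode r s C} =
        vecEquiv hr '' (D.map (LinearMap.fst (ZMod 2) _ _) : Set (Fin r → ZMod 2)) := by
      ext p
      constructor
      · rintro ⟨q, w, hw, h⟩
        exact ⟨w.1, ⟨w, h, rfl⟩, congrArg Prod.fst hw⟩
      · rintro ⟨_, ⟨w, h, rfl⟩, rfl⟩
        exact ⟨ofVec s w.2, w, rfl, h⟩
    rw [h, Nat.card_image_of_injective (vecEquiv hr).injective]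
    refine (natCard_eq_two_pow_finrank (D.map (LinearMap.fst (ZMod 2) _ _))).trans ?_
    congr 1
    omega
  · have h : {q : Rq s | ∃ p : Rq r, (p, q) ∈ dualCode r s C} =
        vecEquiv hs '' (D.map (LinearMap.snd (ZMod 2) _ _) : Set (Fin s → ZMod 2)) := by
      ext q
      constructor
      · rintro ⟨p, w, hw, h⟩
        exact ⟨w.2, ⟨w, h, rfl⟩, congrArg Prod.snd hw⟩
      · rintro ⟨_, ⟨w, h, rfl⟩, rfl⟩
        exact ⟨ofVec r w.1, w, rfl, h⟩
    rw [h, Nat.card_image_of_injective (vecEquiv hs).injective]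
    refine (natCard_eq_two_pow_finrank (D.map (LinearMap.snd (ZMod 2) _ _))).trans ?_
    congr 1
    omega
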